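/- Every finite r-rooted digraph admits a large flame, i.e., a set L ⊆ E that is both a flame and large (Lovász's theorem). -/

import Mathlib

/-- A digraph on vertex type `V` with edge type `E` (parallel edges allowed, no loops). -/
structure MultiDigraph (V : Type*) (E : Type*) where
  tail : E → V
  head : E → V
  no_loops : ∀ e, tail e ≠ head e

namespace MultiDigraph

variable {V E : Type*}

/-- `p` is a (finite) directed path from `s` to `t` in the spanning subdigraph `D(L)`,
identified with its list of edges (consecutive edges are incident, visited vertices
are pairwise distinct). -/
def IsPathIn (D : MultiDigraph V E) (L : Set E) (s t : V) (p : List E) : Prop :=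
  ∃ hne : p ≠ [],
    D.tail (p.head hne) = s ∧
    D.head (p.getLast hne) = t ∧
    p.Chain' (fun e f => D.head e = D.tail f) ∧
    (s :: p.map D.head).Nodup ∧
    ∀ e ∈ p, e ∈ L

/-- `δ_{D(L)}(v)`: the set of ingoing edges of `v` lying in `L`. -/
def delta (D : MultiDigraph V E) (L : Set E) (v : V) : Set E :=
  {e | e ∈ L ∧ D.head e = v}

/-- `δ_{D(L)}(X)`: the set of edges of `D(L)` entering the vertex set `X`
(tail outside `X`, head inside `X`). -/
def edgesInto (D : MultiDigraph V E) (L : Set E) (X : Set V) : Set E :=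
  {e | e ∈ L ∧ D.tail e ∉ X ∧ D.head e ∈ X}

/-- `I ∈ 𝒢_{D(L)}(v)`: `I` is a set of ingoing edges of `v` in `D(L)` for which
there is a set of pairwise edge-disjoint `r`–`v` paths of `D(L)` covering `I`. -/
def MemGv (D : MultiDigraph V E) (L : Set E) (r v : V) (I : Set E) : Prop :=
  I ⊆ D.delta L v ∧
  ∃ Ps : Set (List E),
    (∀ p ∈ Ps, D.IsPathIn L r v p) ∧
    Ps.Pairwise (fun p q => p.Disjoint q) ∧
    ∀ e ∈ I, ∃ p ∈ Ps, e ∈ p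

/-- `L' ∈ 𝒢(D(L))`: `L'` is a union `⋃_{v ≠ r} I_v` with `I_v ∈ 𝒢_{D(L)}(v)`;
equivalently, every edge of `L'` has head distinct from `r` and for each `v ≠ r`
the set of ingoing edges of `v` in `L'` belongs to `𝒢_{D(L)}(v)`. -/
def MemG (D : MultiDigraph V E) (L : Set E) (r : V) (L' : Set E) : Prop :=
  L' ⊆ L ∧ (∀ e ∈ L', D.head e ≠ r) ∧
    ∀ v, v ≠ r → D.MemGv L r v (D.delta L' v)

/-- `F` is a flame: `F ∈ 𝒢(D(F))`. -/
def IsFlame (D : MultiDigraph V E) (r : V) (F : Set E) : Prop :=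
  D.MemG F r F

/-- `C` is a transversal of the set `Ps` of paths: `C` consists of exactly one
edge from each path in `Ps`. -/
def IsTransversal (Ps : Set (List E)) (C : Set E) : Prop :=
  (∀ p ∈ Ps, ∃! e, e ∈ C ∧ e ∈ p) ∧ ∀ e ∈ C, ∃ p ∈ Ps, e ∈ p

/-- `C` is an `s`–`t` cut in `D(L)`: every `s`–`t` path of `D(L)` meets `C`. -/
def IsCut (D : MultiDigraph V E) (L : Set E) (s t : V) (C : Set E) : Prop :=
  ∀ p, D.IsPathIn L s t p → ∃ e ∈ p, e ∈ C

/-- `L` is large at `v`: `D(L)` admits a set `Ps` of pairwise edge-disjoint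
`r`–`v` paths together with a transversal of `Ps` that is an `r`–`v` cut in `D`. -/
def LargeAt (D : MultiDigraph V E) (r v : V) (L : Set E) : Prop :=
  ∃ (Ps : Set (List E)) (C : Set E),
    (∀ p ∈ Ps, D.IsPathIn L r v p) ∧
    Ps.Pairwise (fun p q => p.Disjoint q) ∧
    IsTransversal Ps C ∧
    D.IsCut Set.univ r v C

/-- `L` is large: it is large at every `v ≠ r`. -/
def Large (D : MultiDigraph V E) (r : V) (L : Set E) : Prop :=
  ∀ v, v ≠ r → D.LargeAt r v L

/-- `D` contains a directed cycle. -/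
def HasCycle (D : MultiDigraph V E) : Prop :=
  ∃ (p : List E) (hne : p ≠ []),
    p.Chain' (fun e f => D.head e = D.tail f) ∧
    D.head (p.getLast hne) = D.tail (p.head hne) ∧
    (p.map D.head).Nodup

/-- `D` contains a backward-infinite path: edges `…, f 2, f 1, f 0` (with `f 0` the
last edge, so the path has a final vertex `D.head (f 0)` but no first vertex); the
visited vertices `D.head (f n)` are pairwise distinct. -/
def HasBackwardInfinitePath (D : MultiDigraph V E) : Prop :=
  ∃ f : ℕ → E,
    (∀ n, D.tail (f n) = D.head (f (n + 1))) ∧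
    Function.Injective (fun n => D.head (f n))

/-- `X ⊆ V \ {r}` is `v`-linked in `D(L)`: `v ∈ X` and there is a family
`{P e : e ∈ δ_{D(L)}(X)}` of pairwise edge-disjoint paths of `D(L)`, where `P e`
has `e` as its initial edge and `v` as its terminal vertex. -/
def VLinked (D : MultiDigraph V E) (L : Set E) (r v : V) (X : Set V) : Prop :=
  r ∉ X ∧ v ∈ X ∧
  ∃ P : E → List E,
    (∀ e ∈ D.edgesInto L X, D.IsPathIn L (D.tail e) v (P e) ∧ (P e).head? = some e) ∧
    (D.edgesInto L X).Pairwise (fun e f => (P e).Disjoint (P f))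

/-- `p` is an `r`–`X` path in `D(L)`: a path starting at `r` meeting `X` exactly
in its last vertex. -/
def IsRXPathIn (D : MultiDigraph V E) (L : Set E) (r : V) (X : Set V) (p : List E) : Prop :=
  ∃ hne : p ≠ [],
    D.tail (p.head hne) = r ∧
    D.head (p.getLast hne) ∈ X ∧
    (∀ e ∈ p.dropLast, D.head e ∉ X) ∧
    p.Chain' (fun e f => D.head e = D.tail f) ∧
    (r :: p.map D.head).Nodup ∧
    ∀ e ∈ p, e ∈ L

/-- `X` is fillable in `D(L)`: there is a set `Ps` of pairwise edge-disjoint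
`r`–`X` paths in `D(L)` whose set of terminal edges is exactly `δ_{D(L)}(X)`. -/
def Fillable (D : MultiDigraph V E) (L : Set E) (r : V) (X : Set V) : Prop :=
  ∃ Ps : Set (List E),
    (∀ p ∈ Ps, D.IsRXPathIn L r X p) ∧
    Ps.Pairwise (fun p q => p.Disjoint q) ∧
    {e | ∃ p ∈ Ps, p.getLast? = some e} = D.edgesInto L X

end MultiDigraph

namespace MultiDigraph

open scoped Classical in
/-- The edges of `L` entering the vertex set `X`. -/
noncomputable def entering {V E : Type*} (D : MultiDigraph V E) (L : Finset E) (X : Finset V) :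
    Finset E :=
  {e ∈ L | D.tail e ∉ X ∧ D.head e ∈ X}

open scoped Classical in
/-- The number of edges of `L` entering `X` minus the number of edges of `L` leaving `X`. -/
noncomputable def net {V E : Type*} (D : MultiDigraph V E) (L : Finset E) (X : Finset V) : ℤ :=
  ∑ e ∈ L, ((if D.head e ∈ X then 1 else 0) - (if D.tail e ∈ X then 1 else 0))

section

open scoped Classical

variable {V E : Type*} {D : MultiDigraph V E}

theorem mem_entering {L : Finset E} {X : Finset V} {e : E} :
    e ∈ D.entering L X ↔ e ∈ L ∧ D.tail e ∉ X ∧ D.head e ∈ X := by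
  simp [entering]

theorem card_entering_inter_add_card_entering_union_le (L : Finset E) (X Y : Finset V) :
    (D.entering L (X ∩ Y)).card + (D.entering L (X ∪ Y)).card ≤
      (D.entering L X).card + (D.entering L Y).card := by
  simp only [entering, Finset.card_filter, ← Finset.sum_add_distrib]
  refine Finset.sum_le_sum fun e _ => ?_
  by_cases h1 : D.tail e ∈ X <;> by_cases h2 : D.tail e ∈ Y <;>
    by_cases h3 : D.head e ∈ X <;> by_cases h4 : D.head e ∈ Y <;> simp [h1, h2, h3, h4]

theorem net_nonpos {L : Finset E} {X : Finset V} (h : D.entering L X = ∅) :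
    D.net L X ≤ 0 := by
  refine Finset.sum_nonpos fun e he => ?_
  have : e ∉ D.entering L X := by simp [h]
  rw [mem_entering] at this
  split_ifs <;> simp_all

theorem net_sdiff {L M : Finset E} (h : M ⊆ L) (X : Finset V) :
    D.net (L \ M) X = D.net L X - D.net M X := by
  rw [net, net, net, ← Finset.sum_sdiff h]
  ring

theorem net_eq_sum (L : Finset E) (X : Finset V) :
    D.net L X = ∑ u ∈ X, (({e ∈ L | D.head e = u}.card : ℤ) - {e ∈ L | D.tail e = u}.card) := by
  simp only [net, Finset.card_filter, Nat.cast_sum, ← Finset.sum_sub_distrib]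
  rw [Finset.sum_comm]
  refine Finset.sum_congr rfl fun e _ => ?_
  simp [Finset.sum_sub_distrib]

theorem sum_map_sub_of_isChain (φ : V → ℤ) (p : List E) (hne : p ≠ [])
    (hp : p.IsChain (fun e f => D.head e = D.tail f)) :
    (p.map fun e => φ (D.head e) - φ (D.tail e)).sum =
      φ (D.head (p.getLast hne)) - φ (D.tail (p.head hne)) := by
  induction p with
  | nil => exact absurd rfl hne
  | cons a q ih =>
    cases q with
    | nil => simp
    | cons b q =>
      rw [List.isChain_cons_cons] at hp
      have := ih (by simp) hp.2
      rw [List.map_cons, List.sum_cons, this]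
      simp [hp.1]

theorem IsPathIn.net_toFinset {L : Set E} {r v : V} {p : List E} (hp : D.IsPathIn L r v p)
    {X : Finset V} (hv : v ∈ X) (hr : r ∉ X) : D.net p.toFinset X = 1 := by
  obtain ⟨hne, h1, h2, h3, h4, -⟩ := hp
  rw [net, List.sum_toFinset _ (List.Nodup.of_map _ (List.nodup_cons.1 h4).2),
    sum_map_sub_of_isChain (fun u => if u ∈ X then 1 else 0) p hne h3, h1, h2]
  simp [hv, hr]

theorem IsPathIn.exists_mem_entering {L : Set E} {r v : V} {p : List E}
    (hp : D.IsPathIn L r v p) {X : Finset V} (hv : v ∈ X) (hr : r ∉ X) :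
    ∃ e ∈ p, D.tail e ∉ X ∧ D.head e ∈ X := by
  by_contra! h
  have h0 : D.entering p.toFinset X = ∅ := by
    refine Finset.eq_empty_of_forall_notMem fun e he => ?_
    rw [mem_entering, List.mem_toFinset] at he
    exact h e he.1 he.2.1 he.2.2
  have := net_nonpos h0
  rw [hp.net_toFinset hv hr] at this
  omega

theorem IsPathIn.mono {L M : Set E} (h : L ⊆ M) {r v : V} {p : List E}
    (hp : D.IsPathIn L r v p) : D.IsPathIn M r v p := by
  obtain ⟨hne, h1, h2, h3, h4, h5⟩ := hp
  exact ⟨hne, h1, h2, h3, h4, fun e he => h (h5 e he)⟩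

theorem IsPathIn.exists_extend {L : Set E} {r : V} {p : List E} {e : E}
    (hp : D.IsPathIn L r (D.tail e) p) (he : e ∈ L) (hr : D.head e ≠ r) :
    ∃ q, D.IsPathIn L r (D.head e) q := by
  obtain ⟨hne, h1, h2, h3, h4, h5⟩ := hp
  by_cases hmem : D.head e ∈ p.map D.head
  · obtain ⟨f, hf, hfe⟩ := List.mem_map.1 hmem
    obtain ⟨a, b, rfl⟩ := List.append_of_mem hf
    have hpre : a ++ [f] <+: a ++ f :: b := ⟨b, by simp⟩
    refine ⟨a ++ [f], by simp, ?_, by simpa using hfe, h3.prefix hpre, ?_,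
      fun x hx => h5 x (hpre.subset hx)⟩
    · rw [← h1]
      cases a <;> simp
    · exact h4.sublist ((hpre.sublist.map D.head).cons_cons r)
  · refine ⟨p ++ [e], by simp, ?_, by simp, ?_, ?_, ?_⟩
    · rw [← h1, List.head_append_of_ne_nil hne]
    · refine List.IsChain.append h3 (by simp) fun x hx y hy => ?_
      rw [List.getLast?_eq_some_getLast hne] at hx
      simp only [Option.mem_def, Option.some.injEq, List.head?_cons] at hx hy
      rw [← hx, ← hy, h2]
    · have : r :: (p ++ [e]).map D.head = (r :: p.map D.head) ++ [D.head e] := by simp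
      rw [this, List.nodup_append]
      refine ⟨h4, by simp, fun x hx y hy hxy => ?_⟩
      rw [List.mem_singleton] at hy
      subst hxy hy
      rcases List.mem_cons.1 hx with h | h
      · exact hr h
      · exact hmem h
    · intro x hx
      rcases List.mem_append.1 hx with h | h
      · exact h5 x h
      · rw [List.mem_singleton] at h
        exact h ▸ he

theorem exists_isPathIn [Fintype V] {L : Finset E} {r v : V} (hvr : v ≠ r)
    (h : ∀ X : Finset V, v ∈ X → r ∉ X → 0 < D.net L X) :
    ∃ p, D.IsPathIn (L : Set E) r v p := by
  by_contra hcon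
  let X : Finset V := {u | u ≠ r ∧ ¬ ∃ p, D.IsPathIn (L : Set E) r u p}
  have hX : D.entering L X = ∅ := by
    refine Finset.eq_empty_of_forall_notMem fun e he => ?_
    simp only [mem_entering, X, Finset.mem_filter, Finset.mem_univ, true_and, not_and,
      not_not] at he
    obtain ⟨heL, ht, hh, hno⟩ := he
    by_cases htr : D.tail e = r
    · exact hno ⟨[e], by simp, by simpa using htr, by simp, List.isChain_singleton e,
        by simpa using hh.symm, by simpa using heL⟩
    · obtain ⟨p, hp⟩ := ht htr
      exact hno (hp.exists_extend heL hh)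
  have h1 := h X (by simp [X, hvr, not_exists.1 hcon]) (by simp [X])
  have h2 := net_nonpos hX
  omega

/-- Decomposition of an integral `0`-`1` flow of value `k` into edge-disjoint paths. -/
theorem exists_paths_of_net_eq [Fintype V] {r v : V} (hvr : v ≠ r) (k : ℕ) (L : Finset E)
    (h : ∀ X : Finset V, v ∈ X → r ∉ X → D.net L X = k) :
    ∃ Ps : Finset (List E), Ps.card = k ∧ (∀ p ∈ Ps, D.IsPathIn (L : Set E) r v p) ∧
      (Ps : Set (List E)).Pairwise (fun p q => p.Disjoint q) := by
  induction k generalizing L with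
  | zero => exact ⟨∅, by simp⟩
  | succ k ih =>
    obtain ⟨p, hp⟩ := exists_isPathIn hvr fun X hv hr => by rw [h X hv hr]; positivity
    have hpL : p.toFinset ⊆ L := fun e he => by
      simpa using hp.choose_spec.2.2.2.2 e (by simpa using he)
    obtain ⟨Ps, hcard, hPs, hdisj⟩ := ih (L \ p.toFinset) fun X hv hr => by
      rw [net_sdiff hpL, h X hv hr, hp.net_toFinset hv hr]
      push_cast
      ring
    have hdp : ∀ q ∈ Ps, q.Disjoint p := fun q hq e heq hep => by
      have := (hPs q hq).choose_spec.2.2.2.2 e heq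
      simp [hep] at this
    have hpPs : p ∉ Ps := fun hmem =>
      hdp p hmem (List.head_mem hp.choose) (List.head_mem hp.choose)
    refine ⟨insert p Ps, by simp [hpPs, hcard], ?_, ?_⟩
    · intro q hq
      rcases Finset.mem_insert.1 hq with rfl | hq
      · exact hp
      · exact (hPs q hq).mono (by simp)
    · rw [Finset.coe_insert]
      exact hdisj.insert fun q hq _ => ⟨(hdp q hq).symm, hdp q hq⟩

theorem exists_tight_of_minimal {L : Finset E} {P : V → Finset V → Prop} {k : V → ℕ}
    (hL : Minimal (fun L : Finset E => ∀ w X, P w X → k w ≤ (D.entering L X).card) L)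
    {e : E} (he : e ∈ L) :
    ∃ w X, P w X ∧ (D.entering L X).card = k w ∧ D.tail e ∉ X ∧ D.head e ∈ X := by
  have hnot := hL.not_prop_of_lt (Finset.erase_ssubset he)
  push Not at hnot
  obtain ⟨w, X, hP, hlt⟩ := hnot
  have hle := hL.prop w X hP
  have hmem : e ∈ D.entering L X := by
    by_contra hmem
    refine absurd (Finset.card_le_card fun f hf => ?_) (hlt.trans_le hle).not_ge
    have hfe : f ≠ e := fun h => hmem (h ▸ hf)
    rw [mem_entering] at hf ⊢
    exact ⟨Finset.mem_erase.2 ⟨hfe, hf.1⟩, hf.2⟩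
  have hers : D.entering (L.erase e) X = (D.entering L X).erase e := by
    ext f
    simp [mem_entering, and_assoc]
  rw [hers, Finset.card_erase_of_mem hmem] at hlt
  have := (mem_entering.1 hmem).2
  exact ⟨w, X, hP, by omega, this⟩

/-- A minimal edge set all of whose `r`-`v` cuts have size at least `k` is a flow of value `k`. -/
theorem net_eq_of_minimal [Fintype V] {r v : V} (hvr : v ≠ r) {k : ℕ} {L : Finset E}
    (hL : Minimal (fun L : Finset E => ∀ w X, w = v ∧ v ∈ X ∧ r ∉ X →
      k ≤ (D.entering L X).card) L)
    (X : Finset V) (hv : v ∈ X) (hr : r ∉ X) : D.net L X = k := by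
  have hcut : ∀ X : Finset V, v ∈ X → r ∉ X → k ≤ (D.entering L X).card :=
    fun X h1 h2 => hL.prop v X ⟨rfl, h1, h2⟩
  let Tight : Finset V → Prop := fun X => v ∈ X ∧ r ∉ X ∧ (D.entering L X).card = k
  have htight : ∀ e ∈ L, ∃ X, Tight X ∧ D.tail e ∉ X ∧ D.head e ∈ X := fun e he => by
    obtain ⟨_, X, ⟨-, h1, h2⟩, h3, h4⟩ := exists_tight_of_minimal hL he
    exact ⟨X, ⟨h1, h2, h3⟩, h4⟩
  have huncross : ∀ X Y, Tight X → Tight Y → Tight (X ∩ Y) ∧ Tight (X ∪ Y) := by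
    rintro X Y ⟨h1, h2, h3⟩ ⟨h4, h5, h6⟩
    have hs := card_entering_inter_add_card_entering_union_le (D := D) L X Y
    have hi1 : v ∈ X ∩ Y := Finset.mem_inter.2 ⟨h1, h4⟩
    have hi2 : r ∉ X ∩ Y := fun h => h2 (Finset.mem_inter.1 h).1
    have hu1 : v ∈ X ∪ Y := Finset.mem_union_left _ h1
    have hu2 : r ∉ X ∪ Y := by simp [h2, h5]
    have := hcut _ hi1 hi2
    have := hcut _ hu1 hu2
    exact ⟨⟨hi1, hi2, by omega⟩, hu1, hu2, by omega⟩
  have hin : ∀ u, (∃ e ∈ L, D.head e = u) →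
      ∃ T, Tight T ∧ u ∈ T ∧ ∀ e ∈ L, D.head e = u → D.tail e ∉ T := by
    rintro u ⟨e, he, rfl⟩
    obtain ⟨X, hX, -, hhX⟩ := htight e he
    obtain ⟨T, hT⟩ := exists_minimal_of_wellFoundedLT
      (fun T => Tight T ∧ D.head e ∈ T) ⟨X, hX, hhX⟩
    refine ⟨T, hT.prop.1, hT.prop.2, fun f hf hfe hft => ?_⟩
    obtain ⟨Y, hY, htY, hhY⟩ := htight f hf
    have := hT.le_of_le ⟨(huncross T Y hT.prop.1 hY).1,
      Finset.mem_inter.2 ⟨hT.prop.2, hfe ▸ hhY⟩⟩ Finset.inter_subset_left hft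
    exact htY (Finset.mem_inter.1 this).2
  have hout : ∀ u, (∃ e ∈ L, D.tail e = u) →
      ∃ T, Tight T ∧ u ∉ T ∧ ∀ e ∈ L, D.tail e = u → D.head e ∈ T := by
    rintro u ⟨e, he, rfl⟩
    obtain ⟨X, hX, htX, -⟩ := htight e he
    obtain ⟨T, hT⟩ := exists_maximal_of_wellFoundedGT
      (fun T => Tight T ∧ D.tail e ∉ T) ⟨X, hX, htX⟩
    refine ⟨T, hT.prop.1, hT.prop.2, fun f hf hfe => ?_⟩
    obtain ⟨Y, hY, htY, hhY⟩ := htight f hf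
    have hmem : D.tail e ∉ T ∪ Y := by
      rw [Finset.mem_union, not_or]
      exact ⟨hT.prop.2, hfe ▸ htY⟩
    exact hT.le_of_ge ⟨(huncross T Y hT.prop.1 hY).2, hmem⟩ Finset.subset_union_left
      (Finset.mem_union_right _ hhY)
  have hvertex : ∀ u, u ≠ r → u ≠ v →
      {e ∈ L | D.head e = u}.card = {e ∈ L | D.tail e = u}.card := by
    intro u hur huv
    apply le_antisymm
    · by_cases hex : ∃ e ∈ L, D.head e = u
      · obtain ⟨T, ⟨h1, h2, h3⟩, huT, hT⟩ := hin u hex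
        have hc := hcut (T.erase u) (Finset.mem_erase.2 ⟨huv.symm, h1⟩)
          fun h => h2 (Finset.mem_of_mem_erase h)
        have hle : (D.entering L (T.erase u)).card + {e ∈ L | D.head e = u}.card ≤
            (D.entering L T).card + {e ∈ L | D.tail e = u}.card := by
          simp only [entering, Finset.card_filter, ← Finset.sum_add_distrib]
          refine Finset.sum_le_sum fun e he => ?_
          have := hT e he
          have := D.no_loops e
          by_cases c1 : D.head e = u <;> by_cases c2 : D.tail e = u <;>
            by_cases c3 : D.head e ∈ T <;> by_cases c4 : D.tail e ∈ T <;> simp_all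
        omega
      · push Not at hex
        rw [Finset.filter_eq_empty_iff.2 fun e he => hex e he]
        simp
    · by_cases hex : ∃ e ∈ L, D.tail e = u
      · obtain ⟨T, ⟨h1, h2, h3⟩, huT, hT⟩ := hout u hex
        have hc := hcut (insert u T) (Finset.mem_insert_of_mem h1)
          fun h => (Finset.mem_insert.1 h).elim (fun h => hur h.symm) h2
        have hle : (D.entering L (insert u T)).card + {e ∈ L | D.tail e = u}.card ≤
            (D.entering L T).card + {e ∈ L | D.head e = u}.card := by
          simp only [entering, Finset.card_filter, ← Finset.sum_add_distrib]
          refine Finset.sum_le_sum fun e he => ?_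
          have := hT e he
          have := D.no_loops e
          by_cases c1 : D.head e = u <;> by_cases c2 : D.tail e = u <;>
            by_cases c3 : D.head e ∈ T <;> by_cases c4 : D.tail e ∈ T <;> simp_all
        omega
      · push Not at hex
        rw [Finset.filter_eq_empty_iff.2 fun e he => hex e he]
        simp
  have hv_out : {e ∈ L | D.tail e = v}.card = 0 := by
    rw [Finset.card_eq_zero, Finset.filter_eq_empty_iff]
    rintro e he rfl
    obtain ⟨X, hX, htX, -⟩ := htight e he
    exact htX hX.1
  have hv_in : {e ∈ L | D.head e = v}.card = k := by
    apply le_antisymm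
    · by_cases hex : ∃ e ∈ L, D.head e = v
      · obtain ⟨T, ⟨h1, h2, h3⟩, -, hT⟩ := hin v hex
        rw [← h3]
        refine Finset.card_le_card fun e he => ?_
        rw [Finset.mem_filter] at he
        exact mem_entering.2 ⟨he.1, hT e he.1 he.2, he.2 ▸ h1⟩
      · push Not at hex
        rw [Finset.filter_eq_empty_iff.2 fun e he => hex e he]
        simp
    · refine (hcut {v} (by simp) (by simpa using hvr.symm)).trans (Finset.card_le_card ?_)
      intro e he
      rw [mem_entering, Finset.mem_singleton, Finset.mem_singleton] at he
      exact Finset.mem_filter.2 ⟨he.1, he.2.2⟩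
  rw [net_eq_sum, Finset.sum_eq_single_of_mem v hv, hv_in, hv_out]
  · simp
  · intro u hu huv
    rw [hvertex u (fun h => hr (h ▸ hu)) huv, sub_self]

/-- The directed edge version of the theorem of Menger. -/
theorem exists_paths_of_le_card_entering [Fintype V] {r v : V} (hvr : v ≠ r) {k : ℕ}
    {L : Finset E} (h : ∀ X : Finset V, v ∈ X → r ∉ X → k ≤ (D.entering L X).card) :
    ∃ Ps : Finset (List E), Ps.card = k ∧ (∀ p ∈ Ps, D.IsPathIn (L : Set E) r v p) ∧
      (Ps : Set (List E)).Pairwise (fun p q => p.Disjoint q) := by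
  obtain ⟨M, hML, hM⟩ := exists_minimal_le_of_wellFoundedLT
    (fun L : Finset E => ∀ w X, w = v ∧ v ∈ X ∧ r ∉ X → k ≤ (D.entering L X).card) L
    fun w X hX => h X hX.2.1 hX.2.2
  obtain ⟨Ps, h1, h2, h3⟩ := exists_paths_of_net_eq hvr k M (net_eq_of_minimal hvr hM)
  exact ⟨Ps, h1, fun p hp => (h2 p hp).mono (by exact_mod_cast hML), h3⟩

theorem isTransversal_of_card_le {Ps : Finset (List E)} {C : Finset E}
    (hdisj : (Ps : Set (List E)).Pairwise (fun p q => p.Disjoint q))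
    (hmeet : ∀ p ∈ Ps, ∃ e ∈ p, e ∈ C) (hcard : C.card ≤ Ps.card) :
    IsTransversal (Ps : Set (List E)) (C : Set E) := by
  rcases isEmpty_or_nonempty E with hE | hE
  · exact ⟨fun p hp => isEmptyElim (hmeet p hp).choose, fun e => isEmptyElim e⟩
  choose! f hfp hfC using hmeet
  have hinj : Set.InjOn f Ps := fun p hp q hq hpq => by
    by_contra hne
    exact hdisj hp hq hne (hfp p hp) (hpq ▸ hfp q hq)
  have hsurj : ∀ e ∈ C, ∃ p ∈ Ps, f p = e := fun e he => by
    obtain ⟨p, hp, h⟩ := Finset.surj_on_of_inj_on_of_card_le (fun p _ => f p) hfC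
      (fun p q hp hq h => hinj hp hq h) hcard e he
    exact ⟨p, hp, h.symm⟩
  refine ⟨fun p hp => ⟨f p, ⟨hfC p hp, hfp p hp⟩, ?_⟩, fun e he => ?_⟩
  · rintro e ⟨heC, hep⟩
    obtain ⟨q, hq, rfl⟩ := hsurj e heC
    by_contra hne
    exact hdisj hq hp (fun h => hne (h ▸ rfl)) (hfp q hq) hep
  · obtain ⟨p, hp, rfl⟩ := hsurj e he
    exact ⟨p, hp, hfp p hp⟩

/-- In an edge set minimal subject to `k w ≤ |δ(X)|` for all `w ∈ X ∌ r`, a vertex `v` lying in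
some set attaining its bound has at most `k v` ingoing edges. -/
theorem card_filter_head_le_of_minimal [Fintype V] {r v : V} {k : V → ℕ} {L : Finset E}
    (hL : Minimal (fun L : Finset E => ∀ w X, w ∈ X ∧ r ∉ X →
      k w ≤ (D.entering L X).card) L)
    (hv : ∃ X : Finset V, v ∈ X ∧ r ∉ X ∧ (D.entering L X).card = k v) :
    {e ∈ L | D.head e = v}.card ≤ k v := by
  obtain ⟨T, hT⟩ := exists_minimal_of_wellFoundedLT
    (fun X : Finset V => v ∈ X ∧ r ∉ X ∧ (D.entering L X).card = k v) hv
  obtain ⟨hvT, hrT, hcT⟩ := hT.prop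
  rw [← hcT]
  refine Finset.card_le_card fun e he => ?_
  obtain ⟨heL, rfl⟩ := Finset.mem_filter.1 he
  refine mem_entering.2 ⟨heL, fun htT => ?_, hvT⟩
  obtain ⟨w, X, ⟨hwX, hrX⟩, hcX, htX, hhX⟩ := exists_tight_of_minimal hL heL
  have hs := card_entering_inter_add_card_entering_union_le (D := D) L T X
  have hi1 : D.head e ∈ T ∩ X := Finset.mem_inter.2 ⟨hvT, hhX⟩
  have hi2 : r ∉ T ∩ X := fun h => hrT (Finset.mem_inter.1 h).1
  have := hL.prop (D.head e) (T ∩ X) ⟨hi1, hi2⟩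
  have := hL.prop w (T ∪ X) ⟨Finset.mem_union_right _ hwX, by simp [hrT, hrX]⟩
  have := hT.le_of_le ⟨hi1, hi2, by omega⟩ Finset.inter_subset_left htT
  exact htX (Finset.mem_inter.1 this).2

end

end MultiDigraph

/-- **Lovász.** Every finite `r`-rooted digraph admits a large flame. -/
theorem stmt17 {V E : Type*} [Fintype V] [Fintype E] (D : MultiDigraph V E) (r : V)
    (hroot : ∀ e, D.head e ≠ r) :
    ∃ L : Set E, D.IsFlame r L ∧ D.Large r L := by
  classical
  let k : V → ℕ := fun v =>
    sInf {n | ∃ X : Finset V, v ∈ X ∧ r ∉ X ∧ (D.entering Finset.univ X).card = n}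
  have hk : ∀ v, v ≠ r →
      ∃ X : Finset V, v ∈ X ∧ r ∉ X ∧ (D.entering Finset.univ X).card = k v :=
    fun v hv => Nat.sInf_mem (s := {n | ∃ X : Finset V, v ∈ X ∧ r ∉ X ∧
      (D.entering Finset.univ X).card = n}) ⟨_, {v}, by simp, by simpa using hv.symm, rfl⟩
  obtain ⟨L, hL⟩ := exists_minimal_of_wellFoundedLT
    (fun L : Finset E => ∀ w X, w ∈ X ∧ r ∉ X → k w ≤ (D.entering L X).card)
    ⟨Finset.univ, fun w X hX => Nat.sInf_le ⟨X, hX.1, hX.2, rfl⟩⟩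
  have hpaths := fun v (hv : v ≠ r) => MultiDigraph.exists_paths_of_le_card_entering hv
    fun X h1 h2 => hL.prop v X ⟨h1, h2⟩
  refine ⟨L, ⟨subset_rfl, fun e _ => hroot e, fun v hv => ⟨subset_rfl, ?_⟩⟩, fun v hv => ?_⟩
  · obtain ⟨Ps, hcard, hPs, hdisj⟩ := hpaths v hv
    have hdeg : {e ∈ L | D.head e = v}.card ≤ k v := by
      refine MultiDigraph.card_filter_head_le_of_minimal hL ?_
      obtain ⟨X, h1, h2, h3⟩ := hk v hv
      refine ⟨X, h1, h2, le_antisymm (h3 ▸ Finset.card_le_card fun e he => ?_)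
        (hL.prop v X ⟨h1, h2⟩)⟩
      rw [MultiDigraph.mem_entering] at he ⊢
      exact ⟨Finset.mem_univ _, he.2⟩
    have htr := MultiDigraph.isTransversal_of_card_le hdisj (fun p hp => by
      obtain ⟨e, he, -, hh⟩ := (hPs p hp).exists_mem_entering (X := {v}) (by simp)
        (by simpa using hv.symm)
      exact ⟨e, he, Finset.mem_filter.2
        ⟨by simpa using (hPs p hp).choose_spec.2.2.2.2 e he, by simpa using hh⟩⟩)
      (hdeg.trans hcard.ge)
    exact ⟨Ps, hPs, hdisj, fun e he => htr.2 e (Finset.mem_coe.2 (Finset.mem_filter.2 he))⟩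
  · obtain ⟨Ps, hcard, hPs, hdisj⟩ := hpaths v hv
    obtain ⟨X, h1, h2, h3⟩ := hk v hv
    have hmeet : ∀ M p, D.IsPathIn M r v p → ∃ e ∈ p, e ∈ D.entering Finset.univ X :=
      fun M p hp => by
        obtain ⟨e, he, h⟩ := hp.exists_mem_entering h1 h2
        exact ⟨e, he, MultiDigraph.mem_entering.2 ⟨Finset.mem_univ _, h⟩⟩
    exact ⟨Ps, D.entering Finset.univ X, hPs, hdisj,
      MultiDigraph.isTransversal_of_card_le hdisj (fun p hp => hmeet _ p (hPs p hp))
        (h3.trans hcard.symm).le, fun p hp => hmeet _ p hp⟩
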